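/- arXiv:1203.2813 — 4 statements merged into one kernel-verified Lean document; each statement's English description precedes it below -/
import Mathlib

section
/- Let K be an infinite compact subset of ℝ^d and let s_u denote the local uniform upper box dimension of K. Then the set of measures μ ∈ P(K) satisfying D̲_μ(+∞) = 0 and D̄_μ(+∞) = s_u is residual in P(K) (it contains a dense G_δ set). -/
open MeasureTheory Filter Metric Set Topology

noncomputable section

/-- `ℝ^d` with the Euclidean metric. -/
abbrev Euc (d : ℕ) : Type := EuclideanSpace ℝ (Fin d)

/-- The largest number of pairwise disjoint balls of radius `r` with centers in `E`. -/
noncomputable def packingNumber {X : Type*} [MetricSpace X] (E : Set X) (r : ℝ) : ℕ :=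
  sSup {n : ℕ | ∃ c : Fin n → X, (∀ i, c i ∈ E) ∧
    Pairwise fun i j => Disjoint (ball (c i) r) (ball (c j) r)}

/-- The smallest number of balls of radius `r` needed to cover `E`. -/
noncomputable def coveringNumber {X : Type*} [MetricSpace X] (E : Set X) (r : ℝ) : ℕ :=
  sInf {n : ℕ | ∃ c : Fin n → X, E ⊆ ⋃ i, ball (c i) r}

/-- Upper box (Minkowski) dimension. -/
noncomputable def upperBoxDim {X : Type*} [MetricSpace X] (E : Set X) : EReal :=
  limsup (fun r : ℝ => ((Real.log (coveringNumber E r : ℝ) / (-Real.log r) : ℝ) : EReal))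
    (𝓝[>] (0:ℝ))

/-- Lower box (Minkowski) dimension. -/
noncomputable def lowerBoxDim {X : Type*} [MetricSpace X] (E : Set X) : EReal :=
  liminf (fun r : ℝ => ((Real.log (coveringNumber E r : ℝ) / (-Real.log r) : ℝ) : EReal))
    (𝓝[>] (0:ℝ))

/-- Packing dimension, defined as the modified upper box dimension. -/
noncomputable def packingDim {X : Type*} [MetricSpace X] (E : Set X) : EReal :=
  ⨅ (F : ℕ → Set X) (_ : E ⊆ ⋃ n, F n), ⨆ n, upperBoxDim (F n)

/-- The local uniform upper box dimension. -/
noncomputable def locUnifUpperBoxDim {X : Type*} [MetricSpace X] (K : Set X) : EReal :=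
  ⨅ (N : ℕ) (_ : 1 ≤ N) (x : Fin N → X) (_ : ∀ i, x i ∈ K) (r₀ : ℝ) (_ : 0 < r₀),
    limsup (fun r : ℝ =>
      ((⨅ i : Fin N, Real.log (packingNumber (K ∩ ball (x i) r₀) r : ℝ) / (-Real.log r) : ℝ)
        : EReal)) (𝓝[>] (0:ℝ))

/-- The convex upper box dimension. -/
noncomputable def convUpperBoxDim {X : Type*} [MetricSpace X] (K : Set X) : EReal :=
  ⨅ (N : ℕ) (_ : 1 ≤ N) (x : Fin N → X) (_ : ∀ i, x i ∈ K) (ρ : ℝ) (_ : 0 < ρ)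
    (p : Fin N → ℝ) (_ : ∀ i, 0 < p i) (_ : ∑ i, p i = 1),
    limsup (fun r : ℝ =>
      (((∑ i, p i * Real.log (packingNumber (K ∩ ball (x i) ρ) r : ℝ)) / (-Real.log r) : ℝ)
        : EReal)) (𝓝[>] (0:ℝ))

/-- The maximal convex upper box dimension. -/
noncomputable def convUpperBoxDimMax {X : Type*} [MetricSpace X] (K : Set X) : EReal :=
  ⨆ (y : X) (_ : y ∈ K) (ρ : ℝ) (_ : 0 < ρ), convUpperBoxDim (K ∩ ball y ρ)

/-- `I_μ(r,q)`, with the logarithmic convention at `q = 1`. -/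
noncomputable def Iq {X : Type*} [MetricSpace X] [MeasurableSpace X]
    (μ : Measure X) (r q : ℝ) : ℝ :=
  if q = 1 then ∫ x, Real.log ((μ (ball x r)).toReal) ∂μ
  else ∫ x, ((μ (ball x r)).toReal) ^ (q - 1) ∂μ

/-- The quantity whose `liminf`/`limsup` as `r → 0⁺` gives the lower/upper `L^q`-dimensions. -/
noncomputable def Dq {X : Type*} [MetricSpace X] [MeasurableSpace X]
    (μ : Measure X) (r q : ℝ) : ℝ :=
  if q = 1 then Iq μ r 1 / Real.log r
  else (1 / (q - 1)) * (Real.log (Iq μ r q) / Real.log r)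

/-- The upper `L^q`-dimension of a measure. -/
noncomputable def upperDim {X : Type*} [MetricSpace X] [MeasurableSpace X]
    (μ : Measure X) (q : ℝ) : EReal :=
  limsup (fun r : ℝ => ((Dq μ r q : ℝ) : EReal)) (𝓝[>] (0:ℝ))

/-- The lower `L^q`-dimension of a measure. -/
noncomputable def lowerDim {X : Type*} [MetricSpace X] [MeasurableSpace X]
    (μ : Measure X) (q : ℝ) : EReal :=
  liminf (fun r : ℝ => ((Dq μ r q : ℝ) : EReal)) (𝓝[>] (0:ℝ))

/-- The (topological) support of a measure. -/
noncomputable def msupport {X : Type*} [MetricSpace X] [MeasurableSpace X]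
    (μ : Measure X) : Set X :=
  {x | ∀ r > (0:ℝ), 0 < μ (ball x r)}

/-- The upper `L^∞`-dimension of a measure. -/
noncomputable def upperDimInfty {X : Type*} [MetricSpace X] [MeasurableSpace X]
    (μ : Measure X) : EReal :=
  limsup (fun r : ℝ =>
    ((Real.log (⨆ x ∈ msupport μ, (μ (ball x r)).toReal) / Real.log r : ℝ) : EReal))
    (𝓝[>] (0:ℝ))

/-- The lower `L^∞`-dimension of a measure. -/
noncomputable def lowerDimInfty {X : Type*} [MetricSpace X] [MeasurableSpace X]
    (μ : Measure X) : EReal :=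
  liminf (fun r : ℝ =>
    ((Real.log (⨆ x ∈ msupport μ, (μ (ball x r)).toReal) / Real.log r : ℝ) : EReal))
    (𝓝[>] (0:ℝ))

/-- The upper `L^{-∞}`-dimension of a measure. -/
noncomputable def upperDimNegInfty {X : Type*} [MetricSpace X] [MeasurableSpace X]
    (μ : Measure X) : EReal :=
  limsup (fun r : ℝ =>
    ((Real.log (⨅ x ∈ msupport μ, (μ (ball x r)).toReal) / Real.log r : ℝ) : EReal))
    (𝓝[>] (0:ℝ))

/-- The lower `L^{-∞}`-dimension of a measure. -/
noncomputable def lowerDimNegInfty {X : Type*} [MetricSpace X] [MeasurableSpace X]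
    (μ : Measure X) : EReal :=
  liminf (fun r : ℝ =>
    ((Real.log (⨅ x ∈ msupport μ, (μ (ball x r)).toReal) / Real.log r : ℝ) : EReal))
    (𝓝[>] (0:ℝ))

/-- The half-closed dyadic cube of side `2^{-n}` indexed by `k`. -/
noncomputable def dyadicCube (d n : ℕ) (k : Fin d → ℤ) : Set (Euc d) :=
  {x | ∀ j, (k j : ℝ) / 2 ^ n ≤ x j ∧ x j < ((k j : ℝ) + 1) / 2 ^ n}

/-- `K_n`: the union of the half-closed dyadic cubes of side `2^{-n}` meeting `K`. -/
noncomputable def dyadicHull (d : ℕ) (K : Set (Euc d)) (n : ℕ) : Set (Euc d) :=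
  ⋃ (k : Fin d → ℤ) (_ : (dyadicCube d n k ∩ K).Nonempty), dyadicCube d n k

/-- The number of connected components of a set. -/
noncomputable def numComponents {X : Type*} [TopologicalSpace X] (S : Set X) : ℕ :=
  Nat.card {C : Set X // ∃ x ∈ S, C = connectedComponentIn S x}

/-- The box separation index `bsi(K)`. -/
noncomputable def bsi (d : ℕ) (K : Set (Euc d)) : ℝ :=
  liminf (fun n : ℕ =>
    Real.log (numComponents (dyadicHull d K n) : ℝ) / (n * Real.log 2)) atTop

/-- The Fortet–Mourier distance between two measures. -/
noncomputable def FMdist {X : Type*} [MetricSpace X] [MeasurableSpace X]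
    (μ ν : Measure X) : ℝ :=
  ⨆ f : {f : X → ℝ // LipschitzWith 1 f ∧ ∀ x, |f x| ≤ 1},
    |∫ x, f.1 x ∂μ - ∫ x, f.1 x ∂ν|


section Topology

variable {X : Type*} [MetricSpace X] [MeasurableSpace X]

lemma isOpen_setOf_lt_measure [BorelSpace X] {U : Set X} (hU : IsOpen U) (c : ENNReal) :
    IsOpen {μ : ProbabilityMeasure X | c < (μ : Measure X) U} := by
  refine isOpen_iff_mem_nhds.2 fun μ hμ => ?_
  exact eventually_lt_of_lt_liminf (lt_of_lt_of_le hμ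
    (ProbabilityMeasure.le_liminf_measure_open_of_tendsto (L := 𝓝 μ) (μs := id) tendsto_id hU))

lemma isOpen_setOf_measure_lt [BorelSpace X] {F : Set X} (hF : IsClosed F) (c : ENNReal) :
    IsOpen {μ : ProbabilityMeasure X | (μ : Measure X) F < c} := by
  refine isOpen_iff_mem_nhds.2 fun μ hμ => ?_
  exact eventually_lt_of_limsup_lt (lt_of_le_of_lt
    (ProbabilityMeasure.limsup_measure_closed_le_of_tendsto (L := 𝓝 μ) (μs := id) tendsto_id hF) hμ)

/-- One-sided Lévy–Prokhorov approximability by members of `S` implies that `S` is dense. -/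
lemma dense_of_forall_measure_le_thickening [BorelSpace X] [SecondCountableTopology X]
    {S : Set (ProbabilityMeasure X)}
    (h : ∀ μ : ProbabilityMeasure X, ∀ ε : ℝ, 0 < ε → ∃ μ' ∈ S, ∀ B, MeasurableSet B →
      (μ' : Measure X) B ≤ (μ : Measure X) (thickening ε B) + ENNReal.ofReal ε) :
    Dense S := by
  let Φ := LevyProkhorov.probabilityMeasureHomeomorph (Ω := X)
  have hd : Dense (Φ '' S) := by
    refine Metric.dense_iff.2 fun μ ε hε => ?_
    obtain ⟨μ', hS, hB⟩ := h μ.toMeasure (ε / 2) (by positivity)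
    refine ⟨Φ μ', ?_, mem_image_of_mem _ hS⟩
    have : dist (Φ μ') μ ≤ ε / 2 := by
      rw [LevyProkhorov.dist_probabilityMeasure_def]
      refine levyProkhorovDist_le_of_forall_le _ _ (by positivity) fun η B hη hBm => ?_
      exact (hB B hBm).trans (add_le_add (measure_mono (thickening_mono hη.le B))
        (ENNReal.ofReal_le_ofReal hη.le))
    exact mem_ball.2 (by linarith)
  have := hd.preimage Φ.isOpenMap
  rwa [Φ.injective.preimage_image] at this

/-- Sets of measures that contain every measure with an atom at `x` are dense. -/
lemma dense_of_forall_atom_mem [BorelSpace X] [SecondCountableTopology X] (x : X)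
    {S : Set (ProbabilityMeasure X)}
    (h : ∀ μ : ProbabilityMeasure X, 0 < (μ : Measure X) {x} → μ ∈ S) : Dense S := by
  refine dense_of_forall_measure_le_thickening fun μ ε hε => ?_
  set a : ENNReal := ENNReal.ofReal (min ε 1) with ha
  have ha0 : 0 < a := by simp [ha, hε]
  have ha1 : a ≤ 1 := by simp [ha]
  have hprob : IsProbabilityMeasure ((1 - a) • (μ : Measure X) + a • Measure.dirac x) :=
    ⟨by simp [tsub_add_cancel_of_le ha1]⟩
  refine ⟨⟨_, hprob⟩, h _ ?_, fun B hB => ?_⟩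
  · simp [ha0]
  · simp only [ProbabilityMeasure.coe_mk, Measure.add_apply, Measure.smul_apply, smul_eq_mul]
    refine add_le_add ?_ ?_
    · calc (1 - a) * (μ : Measure X) B ≤ 1 * (μ : Measure X) B := by gcongr; exact tsub_le_self
        _ ≤ _ := by rw [one_mul]; exact measure_mono (self_subset_thickening hε B)
    · calc a * Measure.dirac x B ≤ a * 1 := by gcongr; exact prob_le_one
        _ ≤ _ := by rw [mul_one]; exact ENNReal.ofReal_le_ofReal (min_le_left _ _)

lemma exists_measurable_index [BorelSpace X] [CompactSpace X] [Nonempty X] {ε : ℝ}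
    (hε : 0 < ε) :
    ∃ (N : ℕ) (x : Fin (N + 1) → X) (f : X → Fin (N + 1)), Measurable f ∧
      ∀ z, dist z (x (f z)) < ε := by
  obtain ⟨N, hN⟩ := isCompact_univ.elim_directed_cover
    (fun N : ℕ => ⋃ k ∈ Finset.range (N + 1), ball (TopologicalSpace.denseSeq X k) ε)
    (fun N => isOpen_biUnion fun _ _ => isOpen_ball)
    (fun z _ => show z ∈ _ by
      obtain ⟨k, hk⟩ := Metric.denseRange_iff.1 (TopologicalSpace.denseRange_denseSeq X) z ε hε
      exact mem_iUnion.2 ⟨k, mem_biUnion (Finset.self_mem_range_succ k) hk⟩)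
    (Monotone.directed_le fun m n hmn =>
      biUnion_subset_biUnion_left fun k hk => by simp at hk ⊢; omega)
  refine ⟨N, fun i => TopologicalSpace.denseSeq X i,
    fun z => ⟨SimpleFunc.nearestPtInd (TopologicalSpace.denseSeq X) N z,
    Nat.lt_succ_of_le (SimpleFunc.nearestPtInd_le _ _ _)⟩, ?_, fun z => ?_⟩
  · refine measurable_to_countable' fun i => ?_
    convert (SimpleFunc.nearestPtInd (TopologicalSpace.denseSeq X) N).measurableSet_fiber i using 1
    ext z
    simp [Fin.ext_iff]
  · obtain ⟨k, hk, hz⟩ := mem_iUnion₂.1 (hN (mem_univ z))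
    have h1 := SimpleFunc.edist_nearestPt_le (TopologicalSpace.denseSeq X) z
      (Nat.lt_succ_iff.1 (Finset.mem_range.1 hk))
    rw [edist_dist, edist_dist, ENNReal.ofReal_le_ofReal_iff dist_nonneg] at h1
    rw [dist_comm]
    rw [mem_ball, dist_comm] at hz
    exact h1.trans_lt hz

/-- Replacing the mass of each cell of a small partition by a probability measure living near the
cell moves a measure only a little. -/
lemma sum_fiber_smul_le_thickening {N : ℕ} {ε : ℝ} (μ : ProbabilityMeasure X) (x : Fin N → X)
    {f : X → Fin N} (hf : Measurable f) (hx : ∀ z, dist z (x (f z)) < ε / 2)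
    {ν : Fin N → Measure X} [∀ i, IsProbabilityMeasure (ν i)]
    (hν : ∀ i B, B ∩ ball (x i) (ε / 2) = ∅ → ν i B = 0) (B : Set X) :
    (∑ i, (μ : Measure X) (f ⁻¹' {i}) • ν i) B ≤ (μ : Measure X) (thickening ε B) := by
  classical
  rw [Measure.finsetSum_apply]
  set T := Finset.univ.filter fun i => (B ∩ ball (x i) (ε / 2)).Nonempty with hT
  calc ∑ i, ((μ : Measure X) (f ⁻¹' {i}) • ν i) B
      = ∑ i ∈ T, ((μ : Measure X) (f ⁻¹' {i}) • ν i) B := by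
        refine (Finset.sum_subset (Finset.subset_univ _) fun i _ hi => ?_).symm
        rw [Measure.smul_apply, hν i B (by simpa [hT, not_nonempty_iff_eq_empty] using hi),
          smul_zero]
    _ ≤ ∑ i ∈ T, (μ : Measure X) (f ⁻¹' {i}) :=
        Finset.sum_le_sum fun i _ => by
          rw [Measure.smul_apply, smul_eq_mul]
          exact mul_le_of_le_one_right' prob_le_one
    _ = (μ : Measure X) (f ⁻¹' T) :=
        sum_measure_preimage_singleton _ fun i _ => hf (measurableSet_singleton i)
    _ ≤ _ := measure_mono fun z hz => by
        have hz' : f z ∈ T := hz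
        obtain ⟨b, hb, hb'⟩ := (Finset.mem_filter.1 hz').2
        refine mem_thickening_iff.2 ⟨b, hb, ?_⟩
        have h1 := hx z
        rw [mem_ball] at hb'
        linarith [dist_triangle_right z b (x (f z))]

end Topology

lemma exists_uniform_measure {X : Type*} [MeasurableSpace X] [MeasurableSingletonClass X]
    {n : ℕ} (hn : 0 < n) (c : Fin n → X) :
    ∃ ν : Measure X, IsProbabilityMeasure ν ∧ (∀ B, (∀ j, c j ∉ B) → ν B = 0) ∧
      ∀ B, (∀ i j, c i ∈ B → c j ∈ B → i = j) → ν B ≤ (n : ENNReal)⁻¹ := by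
  have hn0 : (n : ENNReal) ≠ 0 := by exact_mod_cast hn.ne'
  have happ (B : Set X) : ((n : ENNReal)⁻¹ • ∑ j, Measure.dirac (c j)) B =
      (n : ENNReal)⁻¹ * ∑ j, B.indicator 1 (c j) := by
    simp [Measure.smul_apply, Measure.finsetSum_apply]
  refine ⟨(n : ENNReal)⁻¹ • ∑ j, Measure.dirac (c j), ⟨?_⟩, fun B hB => ?_, fun B hB => ?_⟩
  · rw [happ]
    simpa using ENNReal.inv_mul_cancel hn0 (ENNReal.natCast_ne_top n)
  · rw [happ]
    simp [hB]
  · rw [happ]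
    refine mul_le_of_le_one_right' ?_
    by_cases h : ∃ i, c i ∈ B
    · obtain ⟨i, hi⟩ := h
      rw [Finset.sum_eq_single i (fun j _ hji => indicator_of_notMem
        (fun hj => hji (hB j i hj hi)) _) (by simp)]
      simp [hi]
    · push Not at h
      simp [h]

section Packing

variable {d : ℕ} {E : Set (Euc d)} {r : ℝ}

lemma bddAbove_packing (hE : TotallyBounded E) (hr : 0 < r) :
    BddAbove {n : ℕ | ∃ c : Fin n → Euc d, (∀ i, c i ∈ E) ∧
      Pairwise fun i j => Disjoint (ball (c i) r) (ball (c j) r)} := by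
  obtain ⟨t, ht, hEt⟩ := Metric.totallyBounded_iff.1 hE r hr
  refine ⟨ht.toFinset.card, ?_⟩
  rintro n ⟨c, hc, hd⟩
  have hex (i : Fin n) : ∃ y ∈ t, dist (c i) y < r := by
    simpa using hEt (hc i)
  choose g hgt hg using hex
  have hinj : Function.Injective g := by
    intro i j hij
    by_contra hne
    have h1 := (disjoint_ball_ball_iff hr hr).1 (hd hne)
    have h2 := hg i
    have h3 := hg j
    rw [← hij] at h3
    linarith [dist_triangle_right (c i) (c j) (g i)]
  simpa using Finset.card_le_card_of_injOn (s := Finset.univ) (t := ht.toFinset) g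
    (fun i _ => by simpa using hgt i) hinj.injOn

/-- A maximal packing is realized by separated centers whose doubled balls cover. -/
lemma exists_maximal_packing (hE : TotallyBounded E) (hE0 : E.Nonempty) (hr : 0 < r) :
    0 < packingNumber E r ∧ ∃ c : Fin (packingNumber E r) → Euc d, (∀ i, c i ∈ E) ∧
      (Pairwise fun i j => 2 * r ≤ dist (c i) (c j)) ∧ ∀ z ∈ E, ∃ i, dist z (c i) < 2 * r := by
  have hb := bddAbove_packing hE hr
  obtain ⟨y, hy⟩ := hE0
  have hone : 1 ≤ packingNumber E r :=
    le_csSup hb ⟨fun _ => y, fun _ => hy, fun i j hij => (hij (Subsingleton.elim i j)).elim⟩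
  obtain ⟨c, hc, hd⟩ : packingNumber E r ∈ {n : ℕ | ∃ c : Fin n → Euc d, (∀ i, c i ∈ E) ∧
      Pairwise fun i j => Disjoint (ball (c i) r) (ball (c j) r)} :=
    Nat.sSup_mem ⟨0, Fin.elim0, fun i => i.elim0, fun i => i.elim0⟩ hb
  have hsep : Pairwise fun i j => 2 * r ≤ dist (c i) (c j) := fun i j hij => by
    linarith [(disjoint_ball_ball_iff hr hr).1 (hd hij)]
  refine ⟨hone, c, hc, hsep, fun z hz => ?_⟩
  by_contra! hfar
  have hz' : ∀ i, Disjoint (ball z r) (ball (c i) r) := fun i =>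
    (disjoint_ball_ball_iff hr hr).2 (by linarith [hfar i])
  have : packingNumber E r + 1 ≤ packingNumber E r := by
    refine le_csSup hb ⟨Fin.cons z c, fun i => ?_, fun i j hij => ?_⟩
    · exact Fin.cases hz hc i
    · induction i using Fin.cases with
      | zero =>
        induction j using Fin.cases with
        | zero => exact (hij rfl).elim
        | succ j => simpa using hz' j
      | succ i =>
        induction j using Fin.cases with
        | zero => simpa using (hz' i).symm
        | succ j => simpa using hd (fun h => hij (congrArg Fin.succ h))
  omega

end Packing

section Asymptotics

lemma eventually_nhdsGT_zero_lt {b : ℝ} (hb : 0 < b) : ∀ᶠ r : ℝ in 𝓝[>] 0, 0 < r ∧ r < b :=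
  Ioo_mem_nhdsGT hb

lemma eventually_rpow_lt_mul_rpow {a b C : ℝ} (hab : a < b) (hC : 0 < C) :
    ∀ᶠ r : ℝ in 𝓝[>] 0, r ^ b < C * r ^ a := by
  have h0 : Tendsto (fun r : ℝ => r ^ (b - a)) (𝓝[>] 0) (𝓝 0) := by
    have := (Real.continuousAt_rpow_const 0 (b - a) (Or.inr (by linarith))).tendsto
    rw [Real.zero_rpow (by linarith)] at this
    exact this.mono_left nhdsWithin_le_nhds
  filter_upwards [h0.eventually_lt_const hC, eventually_nhdsGT_zero_lt one_pos] with r hr h1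
  have : r ^ b = r ^ (b - a) * r ^ a := by
    rw [← Real.rpow_add h1.1]; ring_nf
  rw [this]
  gcongr
  exact Real.rpow_pos_of_pos h1.1 a

lemma log_div_log_le {r m b : ℝ} (hr : 0 < r) (hr1 : r < 1) (h : r ^ b ≤ m) :
    Real.log m / Real.log r ≤ b := by
  rw [div_le_iff_of_neg (Real.log_neg hr hr1), ← Real.log_rpow hr]
  exact Real.log_le_log (Real.rpow_pos_of_pos hr b) h

lemma le_log_div_log {r m b : ℝ} (hr : 0 < r) (hr1 : r < 1) (hm : 0 < m) (h : m ≤ r ^ b) :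
    b ≤ Real.log m / Real.log r := by
  rw [le_div_iff_of_neg (Real.log_neg hr hr1), ← Real.log_rpow hr]
  exact Real.log_le_log hm h

end Asymptotics

section Dimension

variable {X : Type*} [MetricSpace X] [MeasurableSpace X] {μ : Measure X}

lemma iSup_msupport_eq (h : ∀ x, ∀ r > 0, 0 < μ (ball x r)) (r : ℝ) :
    (⨆ x ∈ msupport μ, (μ (ball x r)).toReal) = ⨆ x, (μ (ball x r)).toReal :=
  iSup_congr fun x => ciSup_pos (f := fun _ => (μ (ball x r)).toReal) (h x)

variable [IsProbabilityMeasure μ]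

lemma bddAbove_measure_ball (r : ℝ) : BddAbove (range fun x => (μ (ball x r)).toReal) :=
  ⟨1, by rintro _ ⟨x, rfl⟩; exact measureReal_le_one⟩

lemma iSup_measure_ball_pos [Nonempty X] (h : ∀ x, ∀ r > 0, 0 < μ (ball x r)) {r : ℝ}
    (hr : 0 < r) : 0 < ⨆ x, (μ (ball x r)).toReal := by
  obtain ⟨x⟩ := ‹Nonempty X›
  exact (ENNReal.toReal_pos (h x r hr).ne' (measure_ne_top _ _)).trans_le
    (le_ciSup (bddAbove_measure_ball r) x)

lemma lowerDimInfty_nonneg [Nonempty X] (h : ∀ x, ∀ r > 0, 0 < μ (ball x r)) :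
    0 ≤ lowerDimInfty μ := by
  refine le_liminf_of_le (by isBoundedDefault) ?_
  filter_upwards [eventually_nhdsGT_zero_lt one_pos] with r hr
  rw [iSup_msupport_eq h]
  refine EReal.coe_nonneg.2 (le_log_div_log hr.1 hr.2 (iSup_measure_ball_pos h hr.1) ?_)
  rw [Real.rpow_zero]
  exact ciSup_le fun x => measureReal_le_one

lemma lowerDimInfty_le_zero [Nonempty X] (h : ∀ x, ∀ r > 0, 0 < μ (ball x r))
    (h' : ∀ n : ℕ, ∃ r : ℝ, (0 < r ∧ r < 1 / ((n : ℝ) + 1)) ∧ ∃ x,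
      ENNReal.ofReal (r ^ (1 / ((n : ℝ) + 1))) < μ (ball x r)) :
    lowerDimInfty μ ≤ 0 := by
  refine le_of_forall_gt fun b hb => ?_
  obtain ⟨c, hc0, hcb⟩ := EReal.lt_iff_exists_real_btwn.1 hb
  have hc0' : 0 < c := EReal.coe_pos.1 hc0
  refine lt_of_le_of_lt ?_ hcb
  refine liminf_le_of_frequently_le ?_ (by isBoundedDefault)
  refine frequently_iff.2 fun {U} hU => ?_
  obtain ⟨δ, hδ, hU⟩ := mem_nhdsGT_iff_exists_Ioo_subset.1 hU
  have hδ' : (0 : ℝ) < δ := hδ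
  obtain ⟨n, hn⟩ := exists_nat_one_div_lt (lt_min hδ' hc0')
  obtain ⟨r, ⟨hr0, hrn⟩, x, hx⟩ := h' n
  refine ⟨r, hU ⟨hr0, hrn.trans (hn.trans_le (min_le_left _ _))⟩, ?_⟩
  rw [iSup_msupport_eq h]
  have hr1 : r < 1 := hrn.trans_le (by
    rw [div_le_one (by positivity)]; linarith [n.cast_nonneg (α := ℝ)])
  refine EReal.coe_le_coe_iff.2 ((log_div_log_le hr0 hr1 ?_).trans
    (hn.le.trans (min_le_right _ _)))
  have := (ENNReal.ofReal_lt_iff_lt_toReal (by positivity) (measure_ne_top _ _)).1 hx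
  exact this.le.trans (le_ciSup (bddAbove_measure_ball r) x)

lemma le_upperDimInfty [Nonempty X] (h : ∀ x, ∀ r > 0, 0 < μ (ball x r)) {t : ℝ}
    (h' : ∀ n : ℕ, ∃ r : ℝ, (0 < r ∧ r < 1 / ((n : ℝ) + 1)) ∧ ∀ x,
      μ (ball x r) ≤ ENNReal.ofReal (r ^ t)) :
    (t : EReal) ≤ upperDimInfty μ := by
  refine le_limsup_of_frequently_le ?_ (by isBoundedDefault)
  refine frequently_iff.2 fun {U} hU => ?_
  obtain ⟨δ, hδ, hU⟩ := mem_nhdsGT_iff_exists_Ioo_subset.1 hU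
  obtain ⟨n, hn⟩ := exists_nat_one_div_lt (show (0 : ℝ) < δ from hδ)
  obtain ⟨r, ⟨hr0, hrn⟩, hx⟩ := h' n
  refine ⟨r, hU ⟨hr0, hrn.trans hn⟩, ?_⟩
  rw [iSup_msupport_eq h]
  have hr1 : r < 1 := hrn.trans_le (by
    rw [div_le_one (by positivity)]; linarith [n.cast_nonneg (α := ℝ)])
  refine EReal.coe_le_coe_iff.2 (le_log_div_log hr0 hr1 (iSup_measure_ball_pos h hr0) ?_)
  exact ciSup_le fun x => ENNReal.toReal_le_of_le_ofReal (by positivity) (hx x)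

end Dimension

section Typical

variable {d : ℕ} {K : Set (Euc d)}

lemma log_div_neg_log_lt_iff {P r c : ℝ} (hP : 0 < P) (hr : 0 < r) (hr1 : r < 1) :
    Real.log P / (-Real.log r) < c ↔ P * r ^ c < 1 := by
  have hl := Real.log_neg hr hr1
  have hrc := Real.rpow_pos_of_pos hr c
  rw [div_lt_iff₀ (by linarith), ← Real.log_neg_iff (by positivity), Real.log_mul hP.ne' hrc.ne',
    Real.log_rpow hr]
  constructor <;> intro h <;> linarith

lemma lt_log_div_neg_log_iff {P r c : ℝ} (hP : 0 < P) (hr : 0 < r) (hr1 : r < 1) :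
    c < Real.log P / (-Real.log r) ↔ 1 < P * r ^ c := by
  have hl := Real.log_neg hr hr1
  have hrc := Real.rpow_pos_of_pos hr c
  rw [lt_div_iff₀ (by linarith), ← Real.log_pos_iff (by positivity), Real.log_mul hP.ne' hrc.ne',
    Real.log_rpow hr]
  constructor <;> intro h <;> linarith

/-- Some ball of radius `2r` carries at least the average mass of a cover by a maximal packing. -/
lemma measure_ball_le_packingNumber_mul (hK : IsCompact K) (μ : Measure K) [IsProbabilityMeasure μ]
    (x : K) {r₀ r : ℝ} (hr₀ : 0 < r₀) (hr : 0 < r) :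
    (μ (ball x r₀)).toReal ≤
      packingNumber (K ∩ ball (x : Euc d) r₀) r * ⨆ y, (μ (ball y (2 * r))).toReal := by
  obtain ⟨-, c, hc, -, hcov⟩ := exists_maximal_packing
    (hK.totallyBounded.subset (inter_subset_left (t := ball (x : Euc d) r₀)))
    ⟨x, x.2, mem_ball_self hr₀⟩ hr
  let c' : Fin (packingNumber (K ∩ ball (x : Euc d) r₀) r) → K := fun i => ⟨c i, (hc i).1⟩
  have hsub : ball x r₀ ⊆ ⋃ i, ball (c' i) (2 * r) := fun z hz => by
    obtain ⟨i, hi⟩ := hcov z ⟨z.2, hz⟩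
    exact mem_iUnion.2 ⟨i, hi⟩
  calc (μ (ball x r₀)).toReal ≤ μ.real (⋃ i, ball (c' i) (2 * r)) := measureReal_mono hsub
    _ ≤ ∑ i, μ.real (ball (c' i) (2 * r)) := measureReal_iUnion_fintype_le _
    _ ≤ ∑ _i, ⨆ y, (μ (ball y (2 * r))).toReal :=
        Finset.sum_le_sum fun i _ => le_ciSup (bddAbove_measure_ball (2 * r)) (c' i)
    _ = _ := by simp

lemma upperDimInfty_le_locUnifUpperBoxDim (hK : IsCompact K) {μ : Measure K}
    [IsProbabilityMeasure μ] (h : ∀ x, ∀ r > 0, 0 < μ (ball x r)) :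
    upperDimInfty μ ≤ locUnifUpperBoxDim K := by
  refine le_iInf fun N => le_iInf fun hN => le_iInf fun x => le_iInf fun hx => le_iInf fun r₀ =>
    le_iInf fun hr₀ => le_of_forall_gt fun b hb => ?_
  have : Nonempty (Fin N) := ⟨⟨0, hN⟩⟩
  obtain ⟨c, hc, hcb⟩ := EReal.lt_iff_exists_real_btwn.1 hb
  obtain ⟨b', hcb', hb'⟩ := EReal.lt_iff_exists_real_btwn.1 hcb
  have hcb'' : c < b' := EReal.coe_lt_coe_iff.1 hcb'
  refine lt_of_le_of_lt ?_ hb'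
  let x' : Fin N → K := fun i => ⟨x i, hx i⟩
  obtain ⟨i₀, hi₀⟩ := Finite.exists_min fun i => (μ (ball (x' i) r₀)).toReal
  set m := (μ (ball (x' i₀) r₀)).toReal with hm
  have hm0 : 0 < m := ENNReal.toReal_pos (h _ _ hr₀).ne' (measure_ne_top _ _)
  have hhalf : Tendsto (fun ρ : ℝ => ρ / 2) (𝓝[>] 0) (𝓝[>] 0) := by
    refine tendsto_nhdsWithin_iff.2 ⟨?_, ?_⟩
    · have : Tendsto (fun ρ : ℝ => ρ / 2) (𝓝 0) (𝓝 (0 / 2)) := tendsto_id.div_const 2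
      rw [zero_div] at this
      exact this.mono_left nhdsWithin_le_nhds
    · filter_upwards [self_mem_nhdsWithin] with ρ hρ using half_pos (mem_Ioi.1 hρ)
  refine limsup_le_of_le (by isBoundedDefault) ?_
  filter_upwards [hhalf.eventually (eventually_lt_of_limsup_lt hc),
    eventually_nhdsGT_zero_lt one_pos,
    eventually_rpow_lt_mul_rpow hcb'' (show 0 < m * (2 ^ c)⁻¹ by positivity)] with ρ h1 h2 h3
  obtain ⟨hρ, hρ1⟩ := h2
  have hρ2 : 0 < ρ / 2 := half_pos hρ
  obtain ⟨i, hi⟩ := exists_lt_of_ciInf_lt (EReal.coe_lt_coe_iff.1 h1)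
  have hpos := (exists_maximal_packing
    (hK.totallyBounded.subset (inter_subset_left (t := ball (x i) r₀)))
    ⟨x i, hx i, mem_ball_self hr₀⟩ hρ2).1
  rw [log_div_neg_log_lt_iff (by exact_mod_cast hpos) hρ2 (by linarith)] at hi
  have hmass := measure_ball_le_packingNumber_mul hK μ (x' i) hr₀ hρ2
  rw [mul_div_cancel₀ ρ two_ne_zero] at hmass
  have : Nonempty K := ⟨x' i₀⟩
  have hM := iSup_measure_ball_pos h hρ
  rw [iSup_msupport_eq h]
  refine EReal.coe_le_coe_iff.2 (log_div_log_le hρ hρ1 (h3.le.trans ?_))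
  have hρc := Real.rpow_pos_of_pos hρ2 c
  calc m * (2 ^ c)⁻¹ * ρ ^ c = m * (ρ / 2) ^ c := by
        rw [Real.div_rpow hρ.le zero_le_two]; ring
    _ ≤ (packingNumber (K ∩ ball (x i) r₀) (ρ / 2) * ⨆ y, (μ (ball y ρ)).toReal) *
          (ρ / 2) ^ c := by
        gcongr
        exact (hi₀ i).trans hmass
    _ = (packingNumber (K ∩ ball (x i) r₀) (ρ / 2) * (ρ / 2) ^ c) *
          ⨆ y, (μ (ball y ρ)).toReal := by ring
    _ ≤ 1 * ⨆ y, (μ (ball y ρ)).toReal := by gcongr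
    _ = _ := one_mul _

/-- Measures which, at some scale below `1 / (n + 1)`, give mass less than `r ^ t` to each
of the doubled balls of a finite cover by balls of radius `r`. -/
def spreadMeasures {X : Type*} [MetricSpace X] [MeasurableSpace X] (t : ℝ) (n : ℕ) :
    Set (ProbabilityMeasure X) :=
  {μ | ∃ r : ℝ, (0 < r ∧ r < 1 / ((n : ℝ) + 1)) ∧ ∃ F : Set X, F.Finite ∧
    univ ⊆ ⋃ y ∈ F, ball y r ∧
    ∀ y ∈ F, (μ : Measure X) (closedBall y (2 * r)) < ENNReal.ofReal (r ^ t)}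

lemma isOpen_spreadMeasures {X : Type*} [MetricSpace X] [MeasurableSpace X] [BorelSpace X]
    (t : ℝ) (n : ℕ) : IsOpen (spreadMeasures (X := X) t n) := by
  have : spreadMeasures (X := X) t n = ⋃ (r : ℝ) (_ : 0 < r ∧ r < 1 / ((n : ℝ) + 1))
      (F : Set X) (_ : F.Finite ∧ univ ⊆ ⋃ y ∈ F, ball y r),
      ⋂ y ∈ F, {μ : ProbabilityMeasure X |
        (μ : Measure X) (closedBall y (2 * r)) < ENNReal.ofReal (r ^ t)} := by
    ext μ
    simp only [spreadMeasures, mem_ofPred_eq, mem_iUnion, mem_iInter, exists_prop, and_assoc]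
  rw [this]
  exact isOpen_iUnion fun r => isOpen_iUnion fun _ => isOpen_iUnion fun F => isOpen_iUnion
    fun hF => hF.1.isOpen_biInter fun y _ => isOpen_setOf_measure_lt isClosed_closedBall _

lemma measure_ball_le_of_mem_spreadMeasures {X : Type*} [MetricSpace X] [MeasurableSpace X]
    {t : ℝ} {n : ℕ} {μ : ProbabilityMeasure X} (hμ : μ ∈ spreadMeasures t n) :
    ∃ r : ℝ, (0 < r ∧ r < 1 / ((n : ℝ) + 1)) ∧
      ∀ x, (μ : Measure X) (ball x r) ≤ ENNReal.ofReal (r ^ t) := by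
  obtain ⟨r, hr, F, -, hF, hlt⟩ := hμ
  refine ⟨r, hr, fun x => ?_⟩
  obtain ⟨y, hy, hxy⟩ := mem_iUnion₂.1 (hF (mem_univ x))
  refine (measure_mono fun z hz => ?_).trans (hlt y hy).le
  rw [mem_ball] at hz hxy
  exact mem_closedBall.2 (by linarith [dist_triangle z x y])

lemma dense_spreadMeasures [Nonempty K] (hK : IsCompact K) {t : ℝ}
    (ht : (t : EReal) < locUnifUpperBoxDim K) (n : ℕ) :
    Dense (spreadMeasures (X := K) t n) := by
  have : CompactSpace K := isCompact_iff_compactSpace.1 hK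
  obtain ⟨t', htt', ht'⟩ := EReal.lt_iff_exists_real_btwn.1 ht
  refine dense_of_forall_measure_le_thickening fun μ ε hε => ?_
  obtain ⟨N, x, f, hf, hx⟩ := exists_measurable_index (X := K) (half_pos hε)
  have hlim := ht'.trans_le (iInf_le_of_le (N + 1) <| iInf_le_of_le (by omega) <|
    iInf_le_of_le (fun i => (x i : Euc d)) <| iInf_le_of_le (fun i => (x i).2) <|
    iInf_le_of_le (ε / 2) <| iInf_le _ (half_pos hε))
  have hfreq := frequently_lt_of_lt_limsup (by isBoundedDefault) hlim
  have hb : (0 : ℝ) < min 1 (4 * (1 / ((n : ℝ) + 1))) := by positivity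
  obtain ⟨ρ, hinf, ⟨hρ, hρb⟩, hpow⟩ := (hfreq.and_eventually
    ((eventually_nhdsGT_zero_lt hb).and
      (eventually_rpow_lt_mul_rpow (EReal.coe_lt_coe_iff.1 htt')
        (show (0 : ℝ) < (4 ^ t)⁻¹ by positivity)))).exists
  have hρ1 : ρ < 1 := hρb.trans_le (min_le_left _ _)
  have hρn : ρ / 4 < 1 / ((n : ℝ) + 1) := by linarith [hρb.trans_le (min_le_right _ _)]
  have hinf' := EReal.coe_lt_coe_iff.1 hinf
  have hpack (i : Fin (N + 1)) := exists_maximal_packing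
    (hK.totallyBounded.subset (inter_subset_left (t := ball (x i : Euc d) (ε / 2))))
    ⟨x i, (x i).2, mem_ball_self (half_pos hε)⟩ hρ
  have hP (i : Fin (N + 1)) :
      1 < (packingNumber (K ∩ ball (x i : Euc d) (ε / 2)) ρ : ℝ) * ρ ^ t' := by
    refine (lt_log_div_neg_log_iff (by exact_mod_cast (hpack i).1) hρ hρ1).1
      (hinf'.trans_le (ciInf_le (Finite.bddBelow_range _) i))
  have hν (i : Fin (N + 1)) : ∃ ν : Measure K, IsProbabilityMeasure ν ∧
      (∀ B, B ∩ ball (x i) (ε / 2) = ∅ → ν B = 0) ∧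
      ∀ y, ν (closedBall y (2 * (ρ / 4))) ≤ ENNReal.ofReal (ρ ^ t') := by
    obtain ⟨hpos, c, hc, hsep, -⟩ := hpack i
    obtain ⟨ν, hprob, hnull, hle⟩ := exists_uniform_measure hpos fun j => (⟨c j, (hc j).1⟩ : K)
    refine ⟨ν, hprob, fun B hB => hnull B fun j hj => ?_,
      fun y => (hle _ fun j k hj hk => ?_).trans ?_⟩
    · exact (hB.subset ⟨hj, (hc j).2⟩ : _ ∈ (∅ : Set K))
    · by_contra hjk
      have h1 := hsep hjk
      have h2 : dist (c j) (y : Euc d) ≤ 2 * (ρ / 4) := hj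
      have h3 : dist (c k) (y : Euc d) ≤ 2 * (ρ / 4) := hk
      linarith [dist_triangle_right (c j) (c k) (y : Euc d)]
    · have hpos' : (0 : ℝ) < packingNumber (K ∩ ball (x i : Euc d) (ε / 2)) ρ := by
        exact_mod_cast hpos
      rw [← ENNReal.ofReal_natCast, ← ENNReal.ofReal_inv_of_pos hpos']
      refine ENNReal.ofReal_le_ofReal ?_
      rw [inv_le_iff_one_le_mul₀' hpos']
      exact (hP i).le
  choose ν hprob hnull hle using hν
  have hsum : ∑ i, (μ : Measure K) (f ⁻¹' {i}) = 1 := by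
    rw [sum_measure_preimage_singleton _ fun i _ => hf (measurableSet_singleton i)]
    simp
  have hμ' : IsProbabilityMeasure (∑ i, (μ : Measure K) (f ⁻¹' {i}) • ν i) :=
    ⟨by simpa [Measure.finsetSum_apply] using hsum⟩
  refine ⟨⟨_, hμ'⟩, ?_, fun B _ =>
    (sum_fiber_smul_le_thickening μ x hf hx hnull B).trans le_self_add⟩
  obtain ⟨F, -, hF, hcov⟩ := finite_cover_balls_of_compact (isCompact_univ (X := K))
    (show 0 < ρ / 4 by positivity)
  refine ⟨ρ / 4, ⟨by positivity, hρn⟩, F, hF, hcov, fun y _ => ?_⟩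
  rw [ProbabilityMeasure.coe_mk, Measure.finsetSum_apply]
  calc ∑ i, ((μ : Measure K) (f ⁻¹' {i}) • ν i) (closedBall y (2 * (ρ / 4)))
      ≤ ∑ i, (μ : Measure K) (f ⁻¹' {i}) * ENNReal.ofReal (ρ ^ t') :=
        Finset.sum_le_sum fun i _ => by
          rw [Measure.smul_apply, smul_eq_mul]
          gcongr
          exact hle i y
    _ = ENNReal.ofReal (ρ ^ t') := by rw [← Finset.sum_mul, hsum, one_mul]
    _ < ENNReal.ofReal ((ρ / 4) ^ t) := by
        refine (ENNReal.ofReal_lt_ofReal_iff (by positivity)).2 (hpow.trans_eq ?_)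
        rw [Real.div_rpow hρ.le (by norm_num)]
        ring

/-- Measures giving some ball of radius `r < 1 / (n + 1)` mass larger than `r ^ (1 / (n + 1))`. -/
def concentratedMeasures {X : Type*} [MetricSpace X] [MeasurableSpace X] (n : ℕ) :
    Set (ProbabilityMeasure X) :=
  {μ | ∃ r : ℝ, (0 < r ∧ r < 1 / ((n : ℝ) + 1)) ∧ ∃ x,
    ENNReal.ofReal (r ^ (1 / ((n : ℝ) + 1))) < (μ : Measure X) (ball x r)}

lemma isOpen_concentratedMeasures {X : Type*} [MetricSpace X] [MeasurableSpace X] [BorelSpace X]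
    (n : ℕ) : IsOpen (concentratedMeasures (X := X) n) := by
  have : concentratedMeasures (X := X) n = ⋃ (r : ℝ) (_ : 0 < r ∧ r < 1 / ((n : ℝ) + 1)) (x : X),
      {μ : ProbabilityMeasure X |
        ENNReal.ofReal (r ^ (1 / ((n : ℝ) + 1))) < (μ : Measure X) (ball x r)} := by
    ext μ
    simp only [concentratedMeasures, mem_ofPred_eq, mem_iUnion, exists_prop]
  rw [this]
  exact isOpen_iUnion fun r => isOpen_iUnion fun _ => isOpen_iUnion fun x =>
    isOpen_setOf_lt_measure isOpen_ball _

lemma dense_concentratedMeasures {X : Type*} [MetricSpace X] [MeasurableSpace X] [BorelSpace X]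
    [SecondCountableTopology X] [Nonempty X] (n : ℕ) :
    Dense (concentratedMeasures (X := X) n) := by
  obtain ⟨x⟩ := ‹Nonempty X›
  refine dense_of_forall_atom_mem x fun μ hμ => ?_
  have hq : (0 : ℝ) < 1 / ((n : ℝ) + 1) := by positivity
  have hm : 0 < ((μ : Measure X) {x}).toReal := ENNReal.toReal_pos hμ.ne' (measure_ne_top _ _)
  obtain ⟨r, hr, hpow⟩ := ((eventually_nhdsGT_zero_lt hq).and
    (eventually_rpow_lt_mul_rpow hq hm)).exists
  refine ⟨r, hr, x, ?_⟩
  rw [Real.rpow_zero, mul_one] at hpow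
  exact ((ENNReal.ofReal_lt_iff_lt_toReal (Real.rpow_nonneg hr.1.le _)
    (measure_ne_top _ _)).2 hpow).trans_le
    (measure_mono (singleton_subset_iff.2 (mem_ball_self hr.1)))

end Typical

/-- A typical measure on an infinite compact `K ⊆ ℝ^d` satisfies `D̲_μ(+∞) = 0` and
`D̄_μ(+∞) = dim̄_{B,loc,unif}(K)`. -/
theorem typical_dim_infty (d : ℕ) (K : Set (Euc d))
    (hK : IsCompact K) (hKinf : K.Infinite) :
    ∃ G : Set (ProbabilityMeasure ↥K),
      G ⊆ {μ : ProbabilityMeasure ↥K |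
        lowerDimInfty (μ : Measure ↥K) = (0 : EReal) ∧
        upperDimInfty (μ : Measure ↥K) = locUnifUpperBoxDim K} ∧
      Dense G ∧ IsGδ G := by
  have : CompactSpace K := isCompact_iff_compactSpace.1 hK
  have : Nonempty K := hKinf.nonempty.to_subtype
  let Q := {q : ℚ // ((q : ℝ) : EReal) < locUnifUpperBoxDim K}
  let full : ℕ × ℕ → Set (ProbabilityMeasure K) := fun p =>
    {μ | 0 < (μ : Measure K) (ball (TopologicalSpace.denseSeq K p.1) (1 / ((p.2 : ℝ) + 1)))}
  let f : (ℕ × ℕ) ⊕ ℕ ⊕ (Q × ℕ) → Set (ProbabilityMeasure K) :=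
    Sum.elim full (Sum.elim concentratedMeasures fun p => spreadMeasures (p.1.1 : ℝ) p.2)
  have ho : ∀ i, IsOpen (f i) := by
    rintro (p | n | p)
    · exact isOpen_setOf_lt_measure isOpen_ball 0
    · exact isOpen_concentratedMeasures n
    · exact isOpen_spreadMeasures _ _
  have hd : ∀ i, Dense (f i) := by
    rintro (p | n | p)
    · refine dense_of_forall_atom_mem (TopologicalSpace.denseSeq K p.1) fun μ hμ => ?_
      exact hμ.trans_le (measure_mono (singleton_subset_iff.2 (mem_ball_self (by positivity))))
    · exact dense_concentratedMeasures n
    · exact dense_spreadMeasures hK p.1.2 p.2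
  refine ⟨⋂ i, f i, fun μ hμ => ?_, dense_iInter_of_isOpen ho hd, .iInter_of_isOpen ho⟩
  have hμ' := mem_iInter.1 hμ
  have hfull : ∀ x, ∀ r > 0, 0 < (μ : Measure K) (ball x r) := by
    intro x r hr
    obtain ⟨n, hn⟩ := exists_nat_one_div_lt (half_pos hr)
    obtain ⟨k, hk⟩ := Metric.denseRange_iff.1 (TopologicalSpace.denseRange_denseSeq K) x (r / 2)
      (half_pos hr)
    have hkn : 0 < (μ : Measure K) (ball (TopologicalSpace.denseSeq K k) (1 / ((n : ℝ) + 1))) :=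
      hμ' (.inl (k, n))
    refine hkn.trans_le (measure_mono (ball_subset_ball' ?_))
    rw [dist_comm]
    linarith
  refine ⟨le_antisymm (lowerDimInfty_le_zero hfull fun n => hμ' (.inr (.inl n)))
    (lowerDimInfty_nonneg hfull),
    le_antisymm (upperDimInfty_le_locUnifUpperBoxDim hK hfull) ?_⟩
  refine le_of_forall_lt fun a ha => ?_
  obtain ⟨q, haq, hq⟩ := EReal.lt_iff_exists_rat_btwn.1 ha
  exact haq.trans_le (le_upperDimInfty hfull fun n =>
    measure_ball_le_of_mem_spreadMeasures (hμ' (.inr (.inr (⟨q, hq⟩, n)))))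

end
end

section
/- Let K be a compact subset of ℝ^d and let q > 1. There exists a constant C_q > 0 such that for any probability measure μ on K with finite support and any r > 0, there exists δ > 0 such that every ν ∈ P(K) with L(μ,ν) < δ satisfies I_ν(r,q) ≤ C_q · I_μ(2r,q) and I_ν(2r,q) ≥ C_q^{-1} · I_μ(r,q). -/
open MeasureTheory Filter Metric Set Topology

noncomputable section

section FortetMourierStability

lemma abs_integral_le_one_of_abs_le_one {Ω : Type*} [MeasurableSpace Ω]
    (μ : Measure Ω) [IsProbabilityMeasure μ] {f : Ω → ℝ} (hf : ∀ x, |f x| ≤ 1) :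
    |∫ x, f x ∂μ| ≤ 1 := by
  simpa using norm_integral_le_of_norm_le_const (μ := μ) (C := 1)
    (ae_of_all _ fun x => (Real.norm_eq_abs _).trans_le (hf x))

lemma exists_finset_atoms {Ω : Type*} [MeasurableSpace Ω] {μ : Measure Ω} [IsFiniteMeasure μ]
    {s : Finset Ω} (hs : μ (↑s : Set Ω)ᶜ = 0) :
    ∃ S : Finset Ω, μ (↑S : Set Ω)ᶜ = 0 ∧ ∀ x ∈ S, 0 < μ.real {x} := by
  classical
  refine ⟨s.filter fun x => μ {x} ≠ 0, ?_, fun x hx => ?_⟩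
  · refine measure_mono_null (t := (↑s : Set Ω)ᶜ ∪ ⋃ x ∈ s.filter fun x => μ {x} = 0, {x}) ?_ ?_
    · intro x hx
      by_cases h : x ∈ s <;> simp_all
    · exact measure_union_null hs ((measure_biUnion_null_iff (Finset.countable_toSet _)).2
        fun x hx => (Finset.mem_filter.1 hx).2)
  · exact ENNReal.toReal_pos (Finset.mem_filter.1 hx).2 (measure_ne_top _ _)

variable {X : Type*} [MetricSpace X]

/-- The tent of height `t` and slope `1` centred at `x`. -/
def tent (x : X) (t : ℝ) (y : X) : ℝ := max 0 (t - dist y x)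

lemma lipschitzWith_tent (x : X) (t : ℝ) : LipschitzWith 1 (tent x t) := by
  refine LipschitzWith.const_max (LipschitzWith.of_le_add fun y z => ?_) 0
  linarith [dist_triangle z y x, dist_comm y z]

lemma tent_nonneg (x : X) (t : ℝ) (y : X) : 0 ≤ tent x t y := le_max_left _ _

lemma tent_le {t : ℝ} (ht : 0 ≤ t) (x y : X) : tent x t y ≤ t :=
  max_le ht (by linarith [dist_nonneg (x := y) (y := x)])

lemma abs_tent_le_one {t : ℝ} (ht : 0 ≤ t) (ht' : t ≤ 1) (x y : X) : |tent x t y| ≤ 1 := by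
  rw [abs_of_nonneg (tent_nonneg x t y)]
  exact (tent_le ht x y).trans ht'

lemma tent_eq_zero {t : ℝ} {x y : X} (h : t ≤ dist y x) : tent x t y = 0 :=
  max_eq_left (by linarith)

lemma tent_self {t : ℝ} (ht : 0 ≤ t) (x : X) : tent x t x = t := by simp [tent, ht]

lemma exists_pos_separation (S : Finset X) {c : ℝ} (hc : 0 < c) :
    ∃ t > 0, t < c ∧ ∀ x ∈ S, ∀ y ∈ S, y ≠ x → 2 * t ≤ dist y x := by
  have h : ∀ᶠ t : ℝ in 𝓝[>] 0, ∀ x ∈ S, ∀ y ∈ S, y ≠ x → 2 * t ≤ dist y x := by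
    refine (eventually_all_finset S).2 fun x _ => (eventually_all_finset S).2 fun y _ => ?_
    by_cases hxy : y = x
    · simp [hxy]
    · filter_upwards [Ioo_mem_nhdsGT (half_pos (dist_pos.2 hxy))] with t ht _
      linarith [ht.2]
  obtain ⟨t, ht, htS⟩ := (Eventually.and (Ioo_mem_nhdsGT hc) h).exists
  exact ⟨t, ht.1, ht.2, htS⟩

lemma pairwiseDisjoint_ball_of_le_dist {S : Finset X} {t : ℝ}
    (hsep : ∀ x ∈ S, ∀ y ∈ S, y ≠ x → 2 * t ≤ dist y x) :
    (↑S : Set X).PairwiseDisjoint fun x => ball x t := fun x hx y hy hxy =>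
  ball_disjoint_ball (by linarith [hsep y hy x hx hxy])

variable [MeasurableSpace X]

lemma abs_integral_sub_integral_le_FMdist (μ ν : Measure X) [IsProbabilityMeasure μ]
    [IsProbabilityMeasure ν] {f : X → ℝ} (hf : LipschitzWith 1 f) (hf' : ∀ x, |f x| ≤ 1) :
    |∫ x, f x ∂μ - ∫ x, f x ∂ν| ≤ FMdist μ ν := by
  refine le_ciSup (f := fun f : {f : X → ℝ // LipschitzWith 1 f ∧ ∀ x, |f x| ≤ 1} =>
    |∫ x, f.1 x ∂μ - ∫ x, f.1 x ∂ν|) ⟨2, ?_⟩ ⟨f, hf, hf'⟩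
  rintro _ ⟨g, rfl⟩
  have h₁ := abs_le.1 (abs_integral_le_one_of_abs_le_one μ g.2.2)
  have h₂ := abs_le.1 (abs_integral_le_one_of_abs_le_one ν g.2.2)
  exact abs_le.2 ⟨by linarith, by linarith⟩

variable [BorelSpace X]

lemma integrable_tent (ν : Measure X) [IsProbabilityMeasure ν] (x : X) {t : ℝ} (ht : 0 ≤ t)
    (ht' : t ≤ 1) : Integrable (tent x t) ν :=
  Integrable.of_bound (lipschitzWith_tent x t).continuous.measurable.aestronglyMeasurable 1
    (ae_of_all _ (abs_tent_le_one ht ht' x))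

lemma integral_tent_le (ν : Measure X) [IsProbabilityMeasure ν] (x : X) {t : ℝ} (ht : 0 ≤ t)
    (ht' : t ≤ 1) : ∫ y, tent x t y ∂ν ≤ t * ν.real (ball x t) := by
  calc ∫ y, tent x t y ∂ν ≤ ∫ y, (ball x t).indicator (fun _ => t) y ∂ν := by
        refine integral_mono (integrable_tent ν x ht ht')
          ((integrable_const t).indicator measurableSet_ball) fun y => ?_
        by_cases hy : y ∈ ball x t
        · simpa [hy] using tent_le ht x y
        · rw [indicator_of_notMem hy]
          exact (tent_eq_zero (by simpa using hy)).le
    _ = t * ν.real (ball x t) := by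
        rw [integral_indicator_const _ measurableSet_ball, smul_eq_mul, mul_comm]

lemma le_integral_tent (ν : Measure X) [IsProbabilityMeasure ν] (x : X) {t : ℝ} (ht : 0 ≤ t)
    (ht' : 2 * t ≤ 1) : t * ν.real (ball x t) ≤ ∫ y, tent x (2 * t) y ∂ν := by
  calc t * ν.real (ball x t) = ∫ y, (ball x t).indicator (fun _ => t) y ∂ν := by
        rw [integral_indicator_const _ measurableSet_ball, smul_eq_mul, mul_comm]
    _ ≤ ∫ y, tent x (2 * t) y ∂ν := by
        refine integral_mono ((integrable_const t).indicator measurableSet_ball)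
          (integrable_tent ν x (by linarith) ht') fun y => ?_
        by_cases hy : y ∈ ball x t
        · rw [indicator_of_mem hy]
          exact le_max_of_le_right (by linarith [mem_ball.1 hy])
        · rw [indicator_of_notMem hy]
          exact tent_nonneg x _ y

lemma integral_eq_sum_of_measure_compl_eq_zero {μ : Measure X} [IsProbabilityMeasure μ]
    {S : Finset X} (hS : μ (↑S : Set X)ᶜ = 0) (f : X → ℝ) :
    ∫ x, f x ∂μ = ∑ x ∈ S, μ.real {x} * f x := by
  have hr : μ.restrict S = μ := Measure.restrict_eq_self_of_ae_mem (mem_ae_iff.2 hS)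
  rw [← hr, setIntegral_finset _ IntegrableOn.finset, hr]
  rfl

lemma measureReal_eq_sum_of_measure_compl_eq_zero {μ : Measure X} [IsProbabilityMeasure μ]
    {S : Finset X} (hS : μ (↑S : Set X)ᶜ = 0) {A : Set X} [DecidablePred (· ∈ A)]
    (hA : MeasurableSet A) : μ.real A = ∑ x ∈ S with x ∈ A, μ.real {x} := by
  rw [← integral_indicator_one hA, integral_eq_sum_of_measure_compl_eq_zero hS, Finset.sum_filter]
  refine Finset.sum_congr rfl fun x _ => ?_
  by_cases hx : x ∈ A <;> simp [hx]

/-- A tent test function at an atom, supported away from the other atoms, controls the mass of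
the small ball around that atom. -/
lemma abs_sub_measureReal_ball_le {μ ν : Measure X} [IsProbabilityMeasure μ]
    [IsProbabilityMeasure ν] {S : Finset X} (hS : μ (↑S : Set X)ᶜ = 0) {x : X} (hx : x ∈ S)
    {t : ℝ} (ht : 0 < t) (ht' : 2 * t ≤ 1) (hsep : ∀ y ∈ S, y ≠ x → 2 * t ≤ dist y x) :
    t * μ.real {x} - FMdist μ ν ≤ t * ν.real (ball x t) ∧
      t * ν.real (ball x t) ≤ 2 * t * μ.real {x} + FMdist μ ν := by
  have key : ∀ u, 0 ≤ u → u ≤ 2 * t → ∫ y, tent x u y ∂μ = u * μ.real {x} := by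
    intro u hu hut
    rw [integral_eq_sum_of_measure_compl_eq_zero hS, Finset.sum_eq_single_of_mem x hx, tent_self hu,
      mul_comm]
    intro y hy hyx
    rw [tent_eq_zero (hut.trans (hsep y hy hyx)), mul_zero]
  have h₁ := abs_le.1 (abs_integral_sub_integral_le_FMdist μ ν (lipschitzWith_tent x t)
    (abs_tent_le_one ht.le (by linarith) x))
  have h₂ := abs_le.1 (abs_integral_sub_integral_le_FMdist μ ν (lipschitzWith_tent x (2 * t))
    (abs_tent_le_one (by linarith) ht' x))
  rw [key t ht.le (by linarith)] at h₁
  rw [key (2 * t) (by linarith) le_rfl] at h₂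
  have h₃ := integral_tent_le ν x ht.le (by linarith)
  have h₄ := le_integral_tent ν x ht.le ht'
  constructor <;> linarith

lemma integrable_measureReal_ball_rpow [SecondCountableTopology X] (ν : Measure X)
    [IsProbabilityMeasure ν] (r : ℝ) {p : ℝ} (hp : 0 ≤ p) :
    Integrable (fun x => ν.real (ball x r) ^ p) ν := by
  have hm : Measurable fun x => ν (ball x r) := by
    have hs : MeasurableSet {z : X × X | dist z.2 z.1 < r} :=
      (isOpen_lt (by fun_prop) continuous_const).measurableSet
    exact measurable_measure_prodMk_left hs
  refine Integrable.of_bound (hm.ennreal_toReal.pow_const p).aestronglyMeasurable 1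
    (ae_of_all _ fun x => ?_)
  rw [Real.norm_of_nonneg (by positivity)]
  exact Real.rpow_le_one measureReal_nonneg measureReal_le_one hp

section Comparison

variable {μ ν : Measure X} [IsProbabilityMeasure μ] [IsProbabilityMeasure ν] {S : Finset X}
  {r t q : ℝ}

lemma Iq_eq_sum_of_measure_compl_eq_zero (hS : μ (↑S : Set X)ᶜ = 0) (hq : 1 < q) :
    Iq μ r q = ∑ x ∈ S, μ.real {x} * μ.real (ball x r) ^ (q - 1) := by
  rw [Iq, if_neg hq.ne', integral_eq_sum_of_measure_compl_eq_zero hS]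
  rfl

lemma Iq_le_of_measureReal_ball_le [SecondCountableTopology X]
    (hS : μ (↑S : Set X)ᶜ = 0) (hq : 1 < q) (htr : 2 * t ≤ r)
    (hball : ∀ x ∈ S, ν.real (ball x t) ≤ 3 * μ.real {x})
    (hcompl : ∀ x ∈ S, ν.real (⋃ x ∈ S, ball x t)ᶜ ≤ μ.real {x})
    (hcompl' : ν.real (⋃ x ∈ S, ball x t)ᶜ ≤ Iq μ (2 * r) q) (ht : 0 < t) :
    Iq ν r q ≤ 4 ^ q * Iq μ (2 * r) q := by
  classical
  have hp : 0 < q - 1 := by linarith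
  set U : Set X := ⋃ x ∈ S, ball x t with hU
  have hUm : MeasurableSet U := S.measurableSet_biUnion fun x _ => measurableSet_ball
  have hloc : ∀ x ∈ S, ∀ y ∈ ball x t, ν.real (ball y r) ≤ 4 * μ.real (ball x (2 * r)) := by
    intro x hx y hy
    have hsub : ball y r ⊆ (⋃ z ∈ S.filter (· ∈ ball x (2 * r)), ball z t) ∪ Uᶜ := by
      intro w hw
      by_cases hwU : w ∈ U
      · left
        obtain ⟨z, hz, hwz⟩ := mem_iUnion₂.1 hwU
        refine mem_iUnion₂.2 ⟨z, Finset.mem_filter.2 ⟨hz, ?_⟩, hwz⟩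
        rw [mem_ball] at *
        linarith [dist_triangle z w x, dist_triangle w y x, dist_comm z w]
      · exact Or.inr hwU
    have hself : μ.real {x} ≤ μ.real (ball x (2 * r)) :=
      measureReal_mono (singleton_subset_iff.2 (mem_ball_self (by linarith)))
    calc ν.real (ball y r)
        ≤ ν.real (⋃ z ∈ S.filter (· ∈ ball x (2 * r)), ball z t) + ν.real Uᶜ :=
          (measureReal_mono hsub).trans (measureReal_union_le _ _)
      _ ≤ ∑ z ∈ S with z ∈ ball x (2 * r), 3 * μ.real {z} + μ.real (ball x (2 * r)) := by
          gcongr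
          · exact (measureReal_biUnion_finset_le _ _).trans
              (Finset.sum_le_sum fun z hz => hball z (Finset.mem_filter.1 hz).1)
          · exact (hcompl x hx).trans hself
      _ = 4 * μ.real (ball x (2 * r)) := by
          rw [← Finset.mul_sum,
            ← measureReal_eq_sum_of_measure_compl_eq_zero hS measurableSet_ball]
          ring
  have hint : ∀ x ∈ S, Integrable
      ((ball x t).indicator fun _ => (4 * μ.real (ball x (2 * r))) ^ (q - 1)) ν :=
    fun x _ => (integrable_const _).indicator measurableSet_ball
  have hintU : Integrable (Uᶜ.indicator fun _ => (1 : ℝ)) ν :=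
    (integrable_const _).indicator hUm.compl
  calc Iq ν r q = ∫ y, ν.real (ball y r) ^ (q - 1) ∂ν := by rw [Iq, if_neg hq.ne']; rfl
    _ ≤ ∫ y, (∑ x ∈ S, (ball x t).indicator (fun _ => (4 * μ.real (ball x (2 * r))) ^ (q - 1)) y
          + Uᶜ.indicator (fun _ => (1 : ℝ)) y) ∂ν := by
        refine integral_mono (integrable_measureReal_ball_rpow ν r hp.le)
          ((integrable_finsetSum _ hint).add hintU) fun y => ?_
        have hnn : ∀ x ∈ S, 0 ≤ (ball x t).indicator
            (fun _ => (4 * μ.real (ball x (2 * r))) ^ (q - 1)) y :=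
          fun x _ => indicator_nonneg (fun _ _ => by positivity) y
        by_cases hyU : y ∈ U
        · obtain ⟨x, hx, hyx⟩ := mem_iUnion₂.1 hyU
          refine le_add_of_le_of_nonneg ?_ (indicator_nonneg (fun _ _ => zero_le_one) y)
          refine le_trans ?_ (Finset.single_le_sum hnn hx)
          rw [indicator_of_mem hyx]
          exact Real.rpow_le_rpow measureReal_nonneg (hloc x hx y hyx) hp.le
        · refine le_add_of_nonneg_of_le (Finset.sum_nonneg hnn) ?_
          rw [indicator_of_mem (mem_compl hyU)]
          exact Real.rpow_le_one measureReal_nonneg measureReal_le_one hp.le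
    _ = ∑ x ∈ S, ν.real (ball x t) * (4 * μ.real (ball x (2 * r))) ^ (q - 1) + ν.real Uᶜ := by
        rw [integral_add (integrable_finsetSum _ hint) hintU, integral_finsetSum _ hint,
          integral_indicator_const _ hUm.compl]
        simp only [integral_indicator_const _ measurableSet_ball, smul_eq_mul, mul_one]
    _ ≤ ∑ x ∈ S, 3 * μ.real {x} * (4 ^ (q - 1) * μ.real (ball x (2 * r)) ^ (q - 1))
          + Iq μ (2 * r) q := by
        refine add_le_add (Finset.sum_le_sum fun x hx => ?_) hcompl'
        rw [Real.mul_rpow (by norm_num) measureReal_nonneg]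
        exact mul_le_mul_of_nonneg_right (hball x hx) (by positivity)
    _ = (3 * 4 ^ (q - 1) + 1) * Iq μ (2 * r) q := by
        rw [Iq_eq_sum_of_measure_compl_eq_zero hS hq, add_mul, one_mul, Finset.mul_sum]
        congr 1
        exact Finset.sum_congr rfl fun x _ => by ring
    _ ≤ 4 ^ q * Iq μ (2 * r) q := by
        refine mul_le_mul_of_nonneg_right ?_ (measureReal_nonneg.trans hcompl')
        have h₁ : (1 : ℝ) ≤ 4 ^ (q - 1) := Real.one_le_rpow (by norm_num) hp.le
        have h₂ : (4 : ℝ) ^ q = 4 ^ (q - 1) * 4 := by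
          rw [← Real.rpow_add_one (by norm_num), sub_add_cancel]
        linarith

lemma le_Iq_of_le_measureReal_ball [SecondCountableTopology X]
    (hS : μ (↑S : Set X)ᶜ = 0) (hq : 1 < q) (htr : 2 * t ≤ r)
    (hdisj : (↑S : Set X).PairwiseDisjoint fun x => ball x t)
    (hball : ∀ x ∈ S, 4⁻¹ * μ.real {x} ≤ ν.real (ball x t)) :
    (4 ^ q)⁻¹ * Iq μ r q ≤ Iq ν (2 * r) q := by
  classical
  have hp : 0 < q - 1 := by linarith
  have hloc : ∀ x ∈ S, ∀ y ∈ ball x t, 4⁻¹ * μ.real (ball x r) ≤ ν.real (ball y (2 * r)) := by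
    intro x hx y hy
    have hsub : (⋃ z ∈ S.filter (· ∈ ball x r), ball z t) ⊆ ball y (2 * r) := by
      intro w hw
      obtain ⟨z, hz, hwz⟩ := mem_iUnion₂.1 hw
      have hzx := (Finset.mem_filter.1 hz).2
      rw [mem_ball] at *
      linarith [dist_triangle w z y, dist_triangle z x y, dist_comm x y]
    calc 4⁻¹ * μ.real (ball x r) = ∑ z ∈ S with z ∈ ball x r, 4⁻¹ * μ.real {z} := by
          rw [measureReal_eq_sum_of_measure_compl_eq_zero hS measurableSet_ball, Finset.mul_sum]
      _ ≤ ∑ z ∈ S with z ∈ ball x r, ν.real (ball z t) :=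
          Finset.sum_le_sum fun z hz => hball z (Finset.mem_filter.1 hz).1
      _ = ν.real (⋃ z ∈ S.filter (· ∈ ball x r), ball z t) :=
          (measureReal_biUnion_finset
            (hdisj.subset (Finset.coe_subset.2 (Finset.filter_subset _ _))) fun _ _ => measurableSet_ball).symm
      _ ≤ ν.real (ball y (2 * r)) := measureReal_mono hsub
  have hint : ∀ x ∈ S, Integrable
      ((ball x t).indicator fun _ => (4⁻¹ * μ.real (ball x r)) ^ (q - 1)) ν :=
    fun x _ => (integrable_const _).indicator measurableSet_ball
  calc (4 ^ q)⁻¹ * Iq μ r q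
      = ∑ x ∈ S, 4⁻¹ * μ.real {x} * (4⁻¹ * μ.real (ball x r)) ^ (q - 1) := by
        rw [Iq_eq_sum_of_measure_compl_eq_zero hS hq, Finset.mul_sum]
        refine Finset.sum_congr rfl fun x _ => ?_
        have h : (4 : ℝ) ^ q = 4 ^ (q - 1) * 4 := by
          rw [← Real.rpow_add_one (by norm_num), sub_add_cancel]
        rw [Real.mul_rpow (by norm_num) measureReal_nonneg, Real.inv_rpow (by norm_num), h, mul_inv]
        ring
    _ ≤ ∑ x ∈ S, ν.real (ball x t) * (4⁻¹ * μ.real (ball x r)) ^ (q - 1) :=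
        Finset.sum_le_sum fun x hx => mul_le_mul_of_nonneg_right (hball x hx) (by positivity)
    _ = ∫ y, ∑ x ∈ S, (ball x t).indicator
          (fun _ => (4⁻¹ * μ.real (ball x r)) ^ (q - 1)) y ∂ν := by
        rw [integral_finsetSum _ hint]
        simp only [integral_indicator_const _ measurableSet_ball, smul_eq_mul]
    _ ≤ ∫ y, ν.real (ball y (2 * r)) ^ (q - 1) ∂ν := by
        refine integral_mono (integrable_finsetSum _ hint)
          (integrable_measureReal_ball_rpow ν _ hp.le) fun y => ?_
        by_cases hy : ∃ x ∈ S, y ∈ ball x t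
        · obtain ⟨x, hx, hyx⟩ := hy
          dsimp only
          rw [Finset.sum_eq_single_of_mem x hx, indicator_of_mem hyx]
          · exact Real.rpow_le_rpow (by positivity) (hloc x hx y hyx) hp.le
          · intro z hz hzx
            exact indicator_of_notMem (disjoint_right.1 (hdisj hz hx hzx) hyx) _
        · push Not at hy
          dsimp only
          rw [Finset.sum_eq_zero fun x hx => indicator_of_notMem (hy x hx) _]
          positivity
    _ = Iq ν (2 * r) q := by rw [Iq, if_neg hq.ne']; rfl

end Comparison

lemma exists_FMdist_lt_imp_Iq_comparison [SecondCountableTopology X] {μ : Measure X}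
    [IsProbabilityMeasure μ] {s : Finset X} (hs : μ (↑s : Set X)ᶜ = 0) {q : ℝ} (hq : 1 < q)
    {r : ℝ} (hr : 0 < r) :
    ∃ δ > (0 : ℝ), ∀ (ν : Measure X) [IsProbabilityMeasure ν], FMdist μ ν < δ →
      Iq ν r q ≤ 4 ^ q * Iq μ (2 * r) q ∧ (4 ^ q)⁻¹ * Iq μ r q ≤ Iq ν (2 * r) q := by
  obtain ⟨S, hS, hpos⟩ := exists_finset_atoms hs
  obtain ⟨t, ht, htc, hsep⟩ := exists_pos_separation S (c := min (1 / 2) (r / 2)) (by positivity)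
  have ht₁ : 2 * t ≤ 1 := by linarith [min_le_left (1 / 2) (r / 2)]
  have ht₂ : 2 * t ≤ r := by linarith [min_le_right (1 / 2) (r / 2)]
  have hsum : ∑ x ∈ S, μ.real {x} = 1 := by
    simpa using (integral_eq_sum_of_measure_compl_eq_zero hS fun _ => 1).symm
  have hne : S.Nonempty := by
    rw [Finset.nonempty_iff_ne_empty]
    rintro rfl
    simp at hsum
  have hI : 0 < Iq μ (2 * r) q := by
    rw [Iq_eq_sum_of_measure_compl_eq_zero hS hq]
    refine Finset.sum_pos (fun x hx => mul_pos (hpos x hx) (Real.rpow_pos_of_pos ?_ _)) hne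
    exact (hpos x hx).trans_le
      (measureReal_mono (singleton_subset_iff.2 (mem_ball_self (by linarith))))
  have hcard : (1 : ℝ) ≤ S.card := by exact_mod_cast hne.card_pos
  obtain ⟨η, ⟨hη, hηI⟩, hηp⟩ : ∃ η : ℝ, η ∈ Ioo 0 (Iq μ (2 * r) q) ∧
      ∀ x ∈ S, η < μ.real {x} / 2 := by
    refine Eventually.exists (f := 𝓝[>] (0 : ℝ)) (Eventually.and (Ioo_mem_nhdsGT hI) ?_)
    refine (eventually_all_finset S).2 fun x hx => ?_
    filter_upwards [Ioo_mem_nhdsGT (half_pos (hpos x hx))] with η hη using hη.2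
  refine ⟨t * (η / S.card), by positivity, fun ν _ hν => ?_⟩
  have hηc : η / S.card ≤ η := div_le_self hη.le hcard
  have hlow : ∀ x ∈ S, μ.real {x} - η / S.card ≤ ν.real (ball x t) := fun x hx => by
    have h := (abs_sub_measureReal_ball_le (ν := ν) hS hx ht ht₁ (hsep x hx)).1
    exact le_of_mul_le_mul_left (by linarith) ht
  have hup : ∀ x ∈ S, ν.real (ball x t) ≤ 2 * μ.real {x} + η / S.card := fun x hx => by
    have h := (abs_sub_measureReal_ball_le (ν := ν) hS hx ht ht₁ (hsep x hx)).2
    exact le_of_mul_le_mul_left (by linarith) ht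
  have hdisj := pairwiseDisjoint_ball_of_le_dist hsep
  have hcompl : ν.real (⋃ x ∈ S, ball x t)ᶜ ≤ η := by
    rw [probReal_compl_eq_one_sub (S.measurableSet_biUnion fun x _ => measurableSet_ball),
      measureReal_biUnion_finset hdisj fun _ _ => measurableSet_ball]
    have h := Finset.sum_le_sum hlow
    rw [Finset.sum_sub_distrib, hsum, Finset.sum_const, nsmul_eq_mul,
      mul_div_cancel₀ _ (by positivity)] at h
    linarith
  constructor
  · refine Iq_le_of_measureReal_ball_le hS hq ht₂ (fun x hx => ?_) (fun x hx => ?_)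
      (hcompl.trans hηI.le) ht
    · linarith [hup x hx, hηp x hx, hpos x hx]
    · linarith [hηp x hx, hpos x hx]
  · refine le_Iq_of_le_measureReal_ball hS hq ht₂ hdisj fun x hx => ?_
    linarith [hlow x hx, hηp x hx, hpos x hx]

end FortetMourierStability

/-- Stability of `I_μ(r,q)`, `q > 1`, under small Fortet–Mourier perturbations of a finitely
supported measure. -/
theorem Iq_stable_q_gt_one (d : ℕ) (K : Set (Euc d)) (hK : IsCompact K)
    (q : ℝ) (hq : 1 < q) :
    ∃ C > (0:ℝ), ∀ μ : ProbabilityMeasure ↥K,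
      (∃ s : Finset ↥K, (μ : Measure ↥K) ((↑s : Set ↥K)ᶜ) = 0) →
      ∀ r > (0:ℝ), ∃ δ > (0:ℝ), ∀ ν : ProbabilityMeasure ↥K,
        FMdist (μ : Measure ↥K) (ν : Measure ↥K) < δ →
          Iq (ν : Measure ↥K) r q ≤ C * Iq (μ : Measure ↥K) (2*r) q ∧
          C⁻¹ * Iq (μ : Measure ↥K) r q ≤ Iq (ν : Measure ↥K) (2*r) q := by
  refine ⟨4 ^ q, by positivity, fun μ ⟨s, hs⟩ r hr => ?_⟩
  obtain ⟨δ, hδ, h⟩ := exists_FMdist_lt_imp_Iq_comparison hs hq hr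
  exact ⟨δ, hδ, fun ν hν => h ν hν⟩

end
end

section
/- Let G = (V,E) be a finite connected graph, let ε > 0 and let ρ ≥ 1. Then there exist a vertex v_0 ∈ V and positive real numbers (ω_v)_{v∈V} such that: (i) for every v ∈ V∖{v_0} there is a neighbour u of v with ω_v ≤ ε·ω_u^ρ; (ii) ω_{v_0} > 1/2; (iii) Σ_{v∈V} ω_v = 1. -/
open MeasureTheory Filter Metric Set Topology

noncomputable section

/-- A sequence starting at `1/2`, bounded by `δ` afterwards, each term being at most `ε` times
the `ρ`-th power of the previous one. -/
def weightSeq (ε ρ δ : ℝ) : ℕ → ℝ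
  | 0 => 1 / 2
  | n + 1 => min δ (ε * weightSeq ε ρ δ n ^ ρ)

theorem weightSeq_pos {ε δ : ℝ} (hε : 0 < ε) (hδ : 0 < δ) (ρ : ℝ) (n : ℕ) :
    0 < weightSeq ε ρ δ n := by
  induction n with
  | zero => norm_num [weightSeq]
  | succ n ih => exact lt_min hδ (mul_pos hε (Real.rpow_pos_of_pos ih ρ))

theorem SimpleGraph.Connected.exists_adj_dist_eq_succ {V : Type*} {G : SimpleGraph V}
    (hG : G.Connected) {v w : V} (hne : v ≠ w) :
    ∃ u, G.Adj v u ∧ G.dist v w = G.dist u w + 1 := by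
  obtain ⟨p, hp⟩ := hG.exists_walk_length_eq_dist v w
  cases p with
  | nil => exact absurd rfl hne
  | @cons _ u _ h q =>
    refine ⟨u, h, le_antisymm ?_ ?_⟩
    · obtain ⟨r, hr⟩ := hG.exists_walk_length_eq_dist u w
      simpa [hr] using SimpleGraph.dist_le (SimpleGraph.Walk.cons h r)
    · rw [← hp, SimpleGraph.Walk.length_cons]
      exact Nat.succ_le_succ (SimpleGraph.dist_le q)

/-- On a finite connected graph one can find weights summing to `1`, more than `1/2` of the
mass sitting on a distinguished vertex `v₀`, every other vertex having a neighbour `u` with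
`ω v ≤ ε · (ω u)^ρ`. -/
theorem graph_weights {V : Type*} [Fintype V] (G : SimpleGraph V) (hG : G.Connected)
    (ε : ℝ) (hε : 0 < ε) (ρ : ℝ) (hρ : 1 ≤ ρ) :
    ∃ (v₀ : V) (ω : V → ℝ), (∀ v, 0 < ω v) ∧
      (∀ v, v ≠ v₀ → ∃ u, G.Adj v u ∧ ω v ≤ ε * ω u ^ ρ) ∧
      1/2 < ω v₀ ∧ ∑ v, ω v = 1 := by
  classical
  obtain ⟨v₀⟩ := hG.nonempty
  have hcard : (0 : ℝ) ≤ Fintype.card V := Nat.cast_nonneg _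
  set δ : ℝ := 1 / (2 * (Fintype.card V + 1)) with hδ_def
  have hδ : 0 < δ := by positivity
  let a : V → ℝ := fun v => weightSeq ε ρ δ (G.dist v v₀)
  have ha : ∀ v, 0 < a v := fun v => weightSeq_pos hε hδ ρ _
  have haδ : ∀ v ∈ Finset.univ.erase v₀, a v ≤ δ := by
    intro v hv
    obtain ⟨u, -, hu⟩ := hG.exists_adj_dist_eq_succ (Finset.ne_of_mem_erase hv)
    simp only [a, hu]
    exact min_le_left _ _
  have hrest : ∑ v ∈ Finset.univ.erase v₀, a v < 1 / 2 := by
    calc ∑ v ∈ Finset.univ.erase v₀, a v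
        ≤ (Finset.univ.erase v₀).card • δ := Finset.sum_le_card_nsmul _ _ _ haδ
      _ ≤ Fintype.card V * δ := by
          rw [nsmul_eq_mul]
          gcongr
          exact Finset.card_le_univ _
      _ < 1 / 2 := by
          rw [hδ_def, mul_one_div, div_lt_div_iff₀ (by positivity) two_pos]
          linarith
  let ω : V → ℝ := Function.update a v₀ (1 - ∑ v ∈ Finset.univ.erase v₀, a v)
  have hω₀ : ω v₀ = 1 - ∑ v ∈ Finset.univ.erase v₀, a v := Function.update_self ..
  have hω : ∀ v, v ≠ v₀ → ω v = a v := fun v hv => Function.update_of_ne hv _ _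
  have haω : ∀ v, a v ≤ ω v := by
    intro v
    rcases eq_or_ne v v₀ with rfl | hv
    · have : a v = 1 / 2 := by simp [a, weightSeq]
      linarith
    · exact (hω v hv).ge
  refine ⟨v₀, ω, fun v => (ha v).trans_le (haω v), fun v hv => ?_, by linarith, ?_⟩
  · obtain ⟨u, hadj, hu⟩ := hG.exists_adj_dist_eq_succ hv
    refine ⟨u, hadj, ?_⟩
    calc ω v = weightSeq ε ρ δ (G.dist u v₀ + 1) := by rw [hω v hv, ← hu]
      _ ≤ ε * a u ^ ρ := min_le_right _ _
      _ ≤ ε * ω u ^ ρ := by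
          gcongr
          · exact (ha u).le
          · exact haω u
  · rw [← Finset.add_sum_erase _ _ (Finset.mem_univ v₀), hω₀,
      Finset.sum_congr rfl fun v hv => hω v (Finset.ne_of_mem_erase hv)]
    ring

end
end

section
/- Let K be a nonempty compact subset of ℝ^d. For every t > dim̲_B(K) (the lower box dimension of K) and every α > 0, there exist μ ∈ P(K) and r ∈ (0,α) such that μ(B(x,r)) ≥ 2^{-t} r^t for all x ∈ K. -/
open MeasureTheory Filter Metric Set Topology

noncomputable section

/-- The uniform distribution on a finite family of points gives mass at least `1 / n` to every
measurable set containing one of them. -/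
theorem exists_probabilityMeasure_inv_card_le {X : Type*} [MeasurableSpace X] {n : ℕ}
    (hn : n ≠ 0) (y : Fin n → X) :
    ∃ μ : ProbabilityMeasure X, ∀ s, MeasurableSet s → (∃ i, y i ∈ s) →
      (n : ℝ)⁻¹ ≤ ((μ : Measure X) s).toReal := by
  have : NeZero n := ⟨hn⟩
  have hy : Measurable y := measurable_from_top
  let p : Measure (Fin n) := (PMF.uniformOfFintype (Fin n)).toMeasure
  have hp : IsProbabilityMeasure (p.map y) := Measure.isProbabilityMeasure_map hy.aemeasurable
  refine ⟨⟨p.map y, hp⟩, fun s hs ⟨i, hi⟩ => ?_⟩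
  have hle : (n : ENNReal)⁻¹ ≤ p.map y s := by
    rw [Measure.map_apply hy hs]
    calc (n : ENNReal)⁻¹ = p {i} := by
          simp [p]
      _ ≤ p (y ⁻¹' s) := measure_mono (by simpa using hi)
  simpa using ENNReal.toReal_mono (measure_ne_top _ _) hle

/-- A compact set is covered by `coveringNumber` many balls. -/
theorem exists_cover_coveringNumber {X : Type*} [MetricSpace X] {K : Set X} (hK : IsCompact K)
    {r : ℝ} (hr : 0 < r) :
    ∃ c : Fin (coveringNumber K r) → X, K ⊆ ⋃ i, ball (c i) r := by
  refine Nat.sInf_mem (s := {n : ℕ | ∃ c : Fin n → X, K ⊆ ⋃ i, ball (c i) r}) ?_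
  obtain ⟨t, -, ht, hKt⟩ := hK.finite_cover_balls hr
  have := ht.fintype
  refine ⟨Fintype.card t, fun i => ((Fintype.equivFin t).symm i : X), fun x hx => ?_⟩
  obtain ⟨z, hz, hxz⟩ := mem_iUnion₂.1 (hKt hx)
  exact mem_iUnion.2 ⟨Fintype.equivFin t ⟨z, hz⟩, by simpa using hxz⟩

theorem coveringNumber_ne_zero {X : Type*} [MetricSpace X] {K : Set X} (hK : IsCompact K)
    (hne : K.Nonempty) {r : ℝ} (hr : 0 < r) : coveringNumber K r ≠ 0 := by
  obtain ⟨c, hc⟩ := exists_cover_coveringNumber hK hr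
  obtain ⟨x, hx⟩ := hne
  obtain ⟨i, -⟩ := mem_iUnion.1 (hc hx)
  exact i.pos.ne'

/-- A nonempty compact set carries a probability measure giving mass at least
`1 / coveringNumber K r` to every ball of radius `2 * r` centred on it. -/
theorem exists_probabilityMeasure_inv_coveringNumber_le {X : Type*} [MetricSpace X]
    [MeasurableSpace X] [BorelSpace X] {K : Set X} (hK : IsCompact K) (hne : K.Nonempty)
    {r : ℝ} (hr : 0 < r) :
    ∃ μ : ProbabilityMeasure K, ∀ x : K,
      (coveringNumber K r : ℝ)⁻¹ ≤ ((μ : Measure K) (ball x (2 * r))).toReal := by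
  obtain ⟨c, hc⟩ := exists_cover_coveringNumber hK hr
  have hy : ∀ i, ∃ y : K, ∀ x ∈ K, x ∈ ball (c i) r → (y : X) ∈ ball (c i) r := fun i => by
    by_cases h : ∃ x ∈ K, x ∈ ball (c i) r
    · obtain ⟨x, hx, hxi⟩ := h
      exact ⟨⟨x, hx⟩, fun _ _ _ => hxi⟩
    · obtain ⟨x, hx⟩ := hne
      exact ⟨⟨x, hx⟩, fun z hz hzi => (h ⟨z, hz, hzi⟩).elim⟩
  choose y hy using hy
  obtain ⟨μ, hμ⟩ :=
    exists_probabilityMeasure_inv_card_le (coveringNumber_ne_zero hK hne hr) y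
  refine ⟨μ, fun x => hμ _ measurableSet_ball ?_⟩
  obtain ⟨i, hi⟩ := mem_iUnion.1 (hc x.2)
  refine ⟨i, ?_⟩
  have hyi := hy i x x.2 hi
  rw [mem_ball] at hi hyi
  rw [mem_ball, Subtype.dist_eq]
  linarith [dist_triangle_right (y i : X) x (c i)]

/-- Anti-Frostman lemma for the lower box dimension: for every `t` above `dim̲_B(K)` and every
`α > 0` one can find a probability measure on `K` and a radius `r ∈ (0,α)` with
`μ(B(x,r)) ≥ 2^{-t} r^t` for all `x ∈ K`. -/
theorem anti_frostman_lowerBox (d : ℕ) (K : Set (Euc d))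
    (hK : IsCompact K) (hKne : K.Nonempty) :
    ∀ t : ℝ, lowerBoxDim K < (t : EReal) → ∀ α > (0:ℝ),
      ∃ (μ : ProbabilityMeasure ↥K) (r : ℝ), r ∈ Set.Ioo (0:ℝ) α ∧
        ∀ x : ↥K, (2:ℝ) ^ (-t) * r ^ t ≤ ((μ : Measure ↥K) (ball x r)).toReal := by
  intro t ht α hα
  have hfreq := frequently_lt_of_liminf_lt (by isBoundedDefault) ht
  have hsmall : ∀ᶠ s : ℝ in 𝓝[>] 0, s ∈ Ioo 0 (min (α / 2) 1) :=
    Ioo_mem_nhdsGT (by positivity)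
  obtain ⟨s, hs, hs0, hs1⟩ := (hfreq.and_eventually hsmall).exists
  have hsα : s < α / 2 := hs1.trans_le (min_le_left _ _)
  have hlog : 0 < -Real.log s :=
    neg_pos.2 (Real.log_neg hs0 (hs1.trans_le (min_le_right _ _)))
  obtain ⟨μ, hμ⟩ := exists_probabilityMeasure_inv_coveringNumber_le hK hKne hs0
  refine ⟨μ, 2 * s, ⟨by linarith, by linarith⟩, fun x => le_trans ?_ (hμ x)⟩
  have hN : (0 : ℝ) < coveringNumber K s :=
    Nat.cast_pos.2 (Nat.pos_of_ne_zero (coveringNumber_ne_zero hK hKne hs0))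
  rw [Real.mul_rpow zero_le_two hs0.le, ← mul_assoc, ← Real.rpow_add two_pos, neg_add_cancel,
    Real.rpow_zero, one_mul, ← Real.log_le_log_iff (Real.rpow_pos_of_pos hs0 t) (inv_pos.2 hN),
    Real.log_rpow hs0, Real.log_inv]
  rw [EReal.coe_lt_coe_iff, div_lt_iff₀ hlog] at hs
  linarith

end
end
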